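/- Let β > 0, γ ∈ (0,1], and let n ≥ 1 and m be integers. Let s, z : (0,∞) → ℝ be twice differentiable with s(r) > 0 for all r, satisfying the Nielsen–Olesen equations (NO): s'' + s'/r − [z² + (β/2)(s² − 1)] s = 0 and z'' + z'/r − z/r² − z s² = 0 on (0,∞). Assume: z(r) > 0 for r in some interval (0,a); z(r) → 0 and r z(r) → 0 as r → ∞; (z(r) − n/r)/r → z₀ and z'(r) + z(r)/r → 2z₀ as r → 0⁺ for some real z₀; z'(r) + z(r)/r → 0 as r → ∞; r ↦ z s² is integrable on (0,∞); moreover r ↦ r^{−n} s(r) and r ↦ z(r) − n/r extend to real-analytic functions on a neighborhood of 0, with r^{−n} s(r) → s₀ > 0 as r → 0⁺. Define x(r) := (γ−1) z(r) − (2γn+m)/(2r) and y(r) := γ z(r) − (2γn+m)/(2r). Suppose u, v : (0,∞) → ℝ satisfy on (0,∞) the linearized equations (V-lin): v'' + v'/r − v/r² + 2(2y'u + y u' + y u/r) − γ v s² = 0, (U-lin): v' y − v y' + (2y² + (γ/2) s²) u = 0, and (I-lin): (r γ s² u)' + 2r γ x s² v = 0. Assume there exist a real k > −1/2, real numbers u₀,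 v₀, and a δ > 0 such that r^{−k} u(r) and r^{−k} v(r) extend to real-analytic functions on [0,δ) with values u₀ and v₀ at 0; assume u(r) → 0 and v(r) → 0 as r → ∞, and, in case y has no zero on (0,∞), the function Φ(r) := r u v γ s²/y tends to 0 as r → 0⁺ and as r → ∞, Φ' is integrable, and the functions r ↦ 2r[1 + γ s²/(4y²)] γ s² u² and r ↦ 2r (x/y) γ s² v² are integrable on (0,∞). Then u ≡ 0 and v ≡ 0 on (0,∞). -/

import Mathlib

open Set Filter MeasureTheory Topology Real

lemma zero_prop_right {E : Type*} [NormedAddCommGroup E] [NormedSpace ℝ E] (p p' : ℝ → E)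
    (a b : ℝ) (hp : ∀ r ∈ Icc a b, HasDerivAt p (p' r) r)
    (K : ℝ) (hK : ∀ r ∈ Icc a b, ‖p' r‖ ≤ K * ‖p r‖) (h0 : p a = 0) :
    ∀ r ∈ Icc a b, p r = 0 := by
  intro r hr
  have := norm_le_gronwallBound_of_norm_deriv_right_le (f := p) (f' := p') (δ := 0) (K := K)
    (ε := 0) (a := a) (b := b) (fun t ht => (hp t ht).continuousAt.continuousWithinAt)
    (fun t ht => (hp t (Ico_subset_Icc_self ht)).hasDerivWithinAt) (by simp [h0])
    (fun t ht => by simpa using hK t (Ico_subset_Icc_self ht)) r hr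
  rw [gronwallBound_ε0, zero_mul] at this
  exact norm_le_zero_iff.1 this

lemma zero_prop {E : Type*} [NormedAddCommGroup E] [NormedSpace ℝ E] (p p' : ℝ → E)
    (hp : ∀ r : ℝ, 0 < r → HasDerivAt p (p' r) r)
    (hb : ∀ a b : ℝ, 0 < a → ∃ K : ℝ, ∀ r ∈ Icc a b, ‖p' r‖ ≤ K * ‖p r‖)
    (r1 : ℝ) (h1 : 0 < r1) (h0 : p r1 = 0) : ∀ r : ℝ, 0 < r → p r = 0 := by
  intro r hr
  rcases le_total r1 r with h | h
  · obtain ⟨K, hK⟩ := hb r1 r h1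
    exact zero_prop_right p p' r1 r (fun t ht => hp t (h1.trans_le ht.1)) K hK h0 r ⟨h, le_rfl⟩
  · obtain ⟨K, hK⟩ := hb r r1 hr
    have := zero_prop_right (fun t => p (-t)) (fun t => -p' (-t)) (-r1) (-r) (fun t ht => by
      have h2 := hp (-t) (by linarith [ht.2])
      simpa [Function.comp_def] using h2.scomp t (hasDerivAt_neg t)) K (fun t ht => by
      have := hK (-t) ⟨by linarith [ht.2], by linarith [ht.1]⟩
      simpa using this) (by simpa using h0) (-r) ⟨by linarith, le_rfl⟩
    simpa using this

lemma anti_of_deriv (f f' : ℝ → ℝ) (hf : ∀ r : ℝ, 0 < r → HasDerivAt f (f' r) r)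
    (hle : ∀ r : ℝ, 0 < r → f' r ≤ 0) : AntitoneOn f (Ioi 0) := by
  apply antitoneOn_of_deriv_nonpos (convex_Ioi 0)
  · exact fun r hr => (hf r hr).continuousAt.continuousWithinAt
  · intro r hr
    rw [interior_Ioi] at hr
    exact (hf r hr).differentiableAt.differentiableWithinAt
  · intro r hr
    rw [interior_Ioi] at hr
    rw [(hf r hr).deriv]
    exact hle r hr

lemma anti_ge (f : ℝ → ℝ) (L : ℝ) (hf : AntitoneOn f (Ioi 0)) (h : Tendsto f atTop (𝓝 L)) :
    ∀ r : ℝ, 0 < r → L ≤ f r := by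
  intro r hr
  refine le_of_tendsto h ?_
  filter_upwards [eventually_ge_atTop r] with t ht
  exact hf hr (hr.trans_le ht) ht

lemma anti_le (f : ℝ → ℝ) (L : ℝ) (hf : AntitoneOn f (Ioi 0)) (h : Tendsto f (𝓝[>] 0) (𝓝 L)) :
    ∀ r : ℝ, 0 < r → f r ≤ L := by
  intro r hr
  refine ge_of_tendsto h ?_
  filter_upwards [Ioo_mem_nhdsGT hr] with t ht
  exact hf ht.1 hr ht.2.le

lemma bdd_of_cont (c : ℝ → ℝ) (hc : ContinuousOn c (Ioi 0)) (a b : ℝ) (ha : 0 < a) :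
    ∃ K : ℝ, 0 ≤ K ∧ ∀ r ∈ Icc a b, |c r| ≤ K := by
  obtain ⟨K, hK⟩ := isCompact_Icc.exists_bound_of_continuousOn
    (hc.mono (fun t (ht : t ∈ Icc a b) => ha.trans_le ht.1))
  exact ⟨|K|, abs_nonneg _, fun r hr => (hK r hr).trans (le_abs_self K)⟩

/-- The function `r z` lies strictly between `0` and `n`. -/
lemma f_bounds (n : ℤ) (hn : 1 ≤ n) (s z z' z'' : ℝ → ℝ)
    (hsc : ContinuousOn s (Ioi 0))
    (hzd : ∀ r ∈ Set.Ioi (0:ℝ), HasDerivAt z (z' r) r)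
    (hzd' : ∀ r ∈ Set.Ioi (0:ℝ), HasDerivAt z' (z'' r) r)
    (hspos : ∀ r : ℝ, 0 < r → 0 < s r)
    (hNOz : ∀ r ∈ Set.Ioi (0:ℝ),
      z'' r + z' r / r - z r / r ^ 2 - z r * s r ^ 2 = 0)
    (hrzinf : Filter.Tendsto (fun r => r * z r) Filter.atTop (nhds 0))
    (hf0 : Tendsto (fun r => r * z r) (𝓝[>] 0) (𝓝 (n:ℝ)))
    (hginf : Filter.Tendsto (fun r => z' r + z r / r) Filter.atTop (nhds 0)) :
    ∀ r : ℝ, 0 < r → 0 < r * z r ∧ r * z r < n := by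
  have hn' : (1:ℝ) ≤ n := by exact_mod_cast hn
  have hg : ∀ r : ℝ, 0 < r → HasDerivAt (fun r => z' r + z r / r) (z r * s r ^ 2) r := by
    intro r hr
    have h := (hzd' r hr).add ((hzd r hr).div (hasDerivAt_id r) hr.ne')
    refine h.congr_deriv ?_
    have := hNOz r hr
    have e : z'' r + (z' r * id r - z r * 1) / id r ^ 2 = z'' r + z' r / r - z r / r ^ 2 := by
      simp only [id]; field_simp; ring
    rw [e]; linarith
  have hf : ∀ r : ℝ, 0 < r → HasDerivAt (fun r => r * z r) (r * (z' r + z r / r)) r := by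
    intro r hr
    refine ((hasDerivAt_id r).mul (hzd r hr)).congr_deriv ?_
    simp only [id]; field_simp; ring
  -- the product `f g` is nonpositive
  have hfg : ∀ r : ℝ, 0 < r → (r * z r) * (z' r + z r / r) ≤ 0 := by
    have hanti : AntitoneOn (fun r => -((r * z r) * (z' r + z r / r))) (Ioi 0) := by
      refine anti_of_deriv _ _ (fun r hr => ((hf r hr).mul (hg r hr)).neg) ?_
      intro r hr
      have h1 : 0 ≤ r * (z' r + z r / r) ^ 2 := by positivity
      have h2 : 0 ≤ r * (z r * s r) ^ 2 := by positivity
      nlinarith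
    intro r hr
    have := anti_ge _ 0 hanti (by simpa using (hrzinf.mul hginf).neg) r hr
    simpa using this
  have hsq : AntitoneOn (fun r => (r * z r) ^ 2) (Ioi 0) := by
    refine anti_of_deriv _ _ (fun r hr => (hf r hr).pow 2) ?_
    intro r hr
    have := mul_nonneg hr.le (neg_nonneg.2 (hfg r hr))
    norm_num
    nlinarith
  have hzc : ContinuousOn (fun r => r * z r) (Ioi 0) :=
    fun r hr => (hf r hr).continuousAt.continuousWithinAt
  -- no zeros
  have hne : ∀ r : ℝ, 0 < r → r * z r ≠ 0 := by
    intro r1 h1 h0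
    have hz1 : z r1 = 0 := by
      rcases mul_eq_zero.1 h0 with h | h
      · exact absurd h h1.ne'
      · exact h
    have hz2 : ∀ r : ℝ, r1 < r → z r = 0 := by
      intro r hr
      have := hsq h1 (h1.trans hr) hr.le
      simp only [h0] at this
      have h3 : r * z r = 0 := by
        have : (r * z r) ^ 2 = 0 := le_antisymm (by simpa using this) (sq_nonneg _)
        exact pow_eq_zero_iff (two_ne_zero) |>.1 this
      rcases mul_eq_zero.1 h3 with h | h
      · linarith
      · exact h
    have hz3 : z' (r1 + 1) = 0 := by
      have h4 : HasDerivAt z 0 (r1 + 1) := by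
        refine (hasDerivAt_const (r1+1) (0:ℝ)).congr_of_eventuallyEq ?_
        filter_upwards [Ioi_mem_nhds (show r1 < r1 + 1 by linarith)] with t ht
        exact hz2 t ht
      exact (hzd (r1+1) (by simp; linarith)).unique h4
    have hz4 := hz2 (r1 + 1) (by linarith)
    have key := zero_prop (fun r => (z r, z' r + z r / r))
      (fun r => ((z' r, z r * s r ^ 2) : ℝ × ℝ))
      (fun r hr => (hzd r hr).prodMk (hg r hr)) (by
        intro a b ha
        obtain ⟨K1, hK1, hb1⟩ := bdd_of_cont (fun r => 1 / r)
          (continuousOn_const.div continuousOn_id (fun r hr => (ne_of_gt hr))) a b ha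
        obtain ⟨K2, hK2, hb2⟩ := bdd_of_cont (fun r => s r ^ 2) (hsc.pow 2) a b ha
        refine ⟨1 + K1 + K2, fun r hr => ?_⟩
        have hb1 := hb1 r hr
        have hb2 := hb2 r hr
        set N := ‖(z r, z' r + z r / r)‖ with hN
        have n1 : |z r| ≤ N := norm_fst_le (z r, z' r + z r / r)
        have n2 : |z' r + z r / r| ≤ N := norm_snd_le (z r, z' r + z r / r)
        have hN0 : 0 ≤ N := norm_nonneg _
        rw [Prod.norm_def]
        refine max_le ?_ ?_
        · simp only [Real.norm_eq_abs]
          have : z' r = (z' r + z r / r) - (1 / r) * z r := by ring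
          rw [this]
          refine (abs_sub _ _).trans ?_
          rw [abs_mul]
          have := mul_le_mul hb1 n1 (abs_nonneg _) hK1
          nlinarith [mul_nonneg hK2 hN0]
        · simp only [Real.norm_eq_abs]
          rw [abs_mul]
          have := mul_le_mul n1 hb2 (abs_nonneg _) hN0
          nlinarith [mul_nonneg hK1 hN0])
      (r1 + 1) (by linarith) (by simp [hz3, hz4])
    have : Tendsto (fun r => r * z r) (𝓝[>] 0) (𝓝 0) := by
      refine (tendsto_const_nhds (x := (0:ℝ))).congr' ?_
      filter_upwards [self_mem_nhdsWithin] with r hr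
      have := congrArg Prod.fst (key r hr)
      simp only [Prod.fst_zero] at this
      rw [this, mul_zero]
    have := tendsto_nhds_unique this hf0
    linarith
  have hpos : ∀ r : ℝ, 0 < r → 0 < r * z r := by
    intro r hr
    by_contra hcon
    push Not at hcon
    have h1 : ∀ᶠ t in 𝓝[>] (0:ℝ), 0 < t * z t := hf0.eventually (lt_mem_nhds (by linarith))
    obtain ⟨t, ht1, ht2⟩ := (h1.and (Ioo_mem_nhdsGT hr)).exists
    have := intermediate_value_Icc' ht2.2.le
      (hzc.mono (fun q (hq : q ∈ Icc t r) => ht2.1.trans_le hq.1))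
    obtain ⟨q, hq, hq0⟩ := this ⟨hcon, ht1.le⟩
    exact hne q (ht2.1.trans_le hq.1) hq0
  have hle : ∀ r : ℝ, 0 < r → (r * z r) ^ 2 ≤ (n:ℝ) ^ 2 :=
    anti_le _ _ hsq (hf0.pow 2)
  intro r hr
  refine ⟨hpos r hr, ?_⟩
  by_contra hcon
  push Not at hcon
  have hcst : ∀ t ∈ Ioc 0 r, t * z t = n := by
    intro t ht
    have h1 := hsq ht.1 hr ht.2
    have h2 := hle t ht.1
    have h3 := hpos t ht.1
    simp only at h1
    have h4 : t * z t ≤ n := by nlinarith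
    have h5 : (n:ℝ) ≤ t * z t := by nlinarith
    linarith
  have hg0 : ∀ t ∈ Ioo 0 r, z' t + z t / t = 0 := by
    intro t ht
    have h4 : HasDerivAt (fun r => r * z r) 0 t := by
      refine (hasDerivAt_const t (n:ℝ)).congr_of_eventuallyEq ?_
      filter_upwards [Ioo_mem_nhds ht.1 ht.2] with q hq
      exact hcst q ⟨hq.1, hq.2.le⟩
    have := (hf t ht.1).unique h4
    exact (mul_eq_zero.1 this).resolve_left ht.1.ne'
  have h5 : HasDerivAt (fun r => z' r + z r / r) 0 (r/2) := by
    refine (hasDerivAt_const (r/2) (0:ℝ)).congr_of_eventuallyEq ?_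
    filter_upwards [Ioo_mem_nhds (show 0 < r/2 by linarith) (show r/2 < r by linarith)] with q hq
    exact hg0 q hq
  have h6 := (hg (r/2) (by linarith)).unique h5
  have h7 := hpos (r/2) (by linarith)
  have h8 := hspos (r/2) (by linarith)
  rcases mul_eq_zero.1 h6 with h | h
  · rw [h] at h7; simp at h7
  · exact h8.ne' (pow_eq_zero_iff (two_ne_zero) |>.1 h)

lemma ev_nhds {P : ℝ → Prop} (h : ∀ᶠ r in 𝓝[>] (0:ℝ), P r) :
    ∀ᶠ r in 𝓝[>] (0:ℝ), ∀ᶠ t in 𝓝 r, P t := by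
  obtain ⟨e, he, hs⟩ := mem_nhdsGT_iff_exists_Ioo_subset.1 h
  filter_upwards [Ioo_mem_nhdsGT he] with r hr
  filter_upwards [Ioo_mem_nhds hr.1 hr.2] with t ht
  exact hs ht

/-- Indicial analysis at the origin. -/
lemma indicial (γ : ℝ) (hγ : 0 < γ) (n : ℤ) (hn : 1 ≤ n) (p X0 Y0 s₀ : ℝ) (hp : -1 < p)
    (hXY : X0 * Y0 < 0) (hs₀ : 0 < s₀)
    (s x y y' u v v' W' F G S : ℝ → ℝ)
    (hF : AnalyticAt ℝ F 0) (hG : AnalyticAt ℝ G 0) (hS : AnalyticAt ℝ S 0) (hS0 : S 0 = s₀)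
    (hu : ∀ᶠ r in 𝓝[>] (0:ℝ), u r = r ^ p * F r)
    (hv : ∀ᶠ r in 𝓝[>] (0:ℝ), v r = r ^ p * G r)
    (hs : ∀ᶠ r in 𝓝[>] (0:ℝ), s r = r ^ (n:ℝ) * S r)
    (hy0 : Tendsto (fun r => r * y r) (𝓝[>] 0) (𝓝 Y0))
    (hy1 : Tendsto (fun r => r ^ 2 * y' r) (𝓝[>] 0) (𝓝 (-Y0)))
    (hx0 : Tendsto (fun r => r * x r) (𝓝[>] 0) (𝓝 X0))
    (hvd : ∀ r ∈ Set.Ioi (0:ℝ), HasDerivAt v (v' r) r)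
    (hWd : ∀ r ∈ Set.Ioi (0:ℝ),
      HasDerivAt (fun t => t * γ * s t ^ 2 * u t) (W' r) r)
    (hUlin : ∀ r ∈ Set.Ioi (0:ℝ),
      v' r * y r - v r * y' r + (2 * y r ^ 2 + γ / 2 * s r ^ 2) * u r = 0)
    (hIlin : ∀ r ∈ Set.Ioi (0:ℝ),
      W' r + 2 * r * γ * x r * s r ^ 2 * v r = 0) : F 0 = 0 ∧ G 0 = 0 := by
  have hn' : (1:ℝ) ≤ n := by exact_mod_cast hn
  have hle : 𝓝[>] (0:ℝ) ≤ 𝓝 0 := nhdsWithin_le_nhds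
  have tid : Tendsto (fun r : ℝ => r) (𝓝[>] 0) (𝓝 0) := hle
  have tF : Tendsto F (𝓝[>] 0) (𝓝 (F 0)) := hF.continuousAt.tendsto.mono_left hle
  have tG : Tendsto G (𝓝[>] 0) (𝓝 (G 0)) := hG.continuousAt.tendsto.mono_left hle
  have tS : Tendsto S (𝓝[>] 0) (𝓝 (S 0)) := hS.continuousAt.tendsto.mono_left hle
  have tG' : Tendsto (deriv G) (𝓝[>] 0) (𝓝 (deriv G 0)) :=
    hG.deriv.continuousAt.tendsto.mono_left hle
  set N : ℝ → ℝ := fun r => S r ^ 2 * F r with hNdef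
  have hN : AnalyticAt ℝ N 0 := (hS.pow 2).mul hF
  have tN : Tendsto N (𝓝[>] 0) (𝓝 (N 0)) := hN.continuousAt.tendsto.mono_left hle
  have tN' : Tendsto (deriv N) (𝓝[>] 0) (𝓝 (deriv N 0)) :=
    hN.deriv.continuousAt.tendsto.mono_left hle
  have ts : Tendsto s (𝓝[>] 0) (𝓝 0) := by
    have h1 : Tendsto (fun r : ℝ => r ^ (n:ℝ)) (𝓝[>] 0) (𝓝 0) := by
      have := (continuousAt_rpow_const (0:ℝ) (n:ℝ) (Or.inr (by linarith))).tendsto.mono_left hle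
      rwa [zero_rpow (by linarith)] at this
    have h2 := h1.mul tS
    rw [zero_mul] at h2
    exact h2.congr' (hs.mono fun r hr => hr.symm)
  -- first relation
  have e1 : ∀ᶠ r in 𝓝[>] (0:ℝ), (p * G r + r * deriv G r) * (r * y r) - G r * (r ^ 2 * y' r)
      + (2 * (r * y r) ^ 2 + γ / 2 * s r ^ 2 * r ^ 2) * F r = 0 := by
    filter_upwards [self_mem_nhdsWithin, hu, hv, ev_nhds hv, hle hG.eventually_analyticAt]
      with r hr hu hv hv2 hGr
    have hr : 0 < r := hr
    have hd : HasDerivAt (fun t => t ^ p * G t) (p * r ^ (p - 1) * G r + r ^ p * deriv G r) r :=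
      (hasDerivAt_rpow_const (Or.inl hr.ne')).mul hGr.differentiableAt.hasDerivAt
    have hv' := (hvd r hr).unique (hd.congr_of_eventuallyEq hv2)
    have hU := hUlin r hr
    rw [hv', hu, hv] at hU
    have h1 : r ^ p = r ^ (p - 2) * r ^ 2 := by
      rw [← rpow_natCast, ← rpow_add hr]; norm_num
    have h2 : r ^ (p - 1) = r ^ (p - 2) * r := by
      rw [← rpow_add_one hr.ne']; ring_nf
    rw [h1, h2] at hU
    have h3 : r ^ (p - 2) ≠ 0 := (rpow_pos_of_pos hr _).ne'
    apply (mul_right_inj' h3).1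
    rw [mul_zero, ← hU]; ring
  have l1 := (((tG.const_mul p).add (tid.mul tG')).mul hy0).sub (tG.mul hy1) |>.add
    ((((hy0.pow 2).const_mul 2).add (((ts.pow 2).const_mul (γ/2)).mul (tid.pow 2))).mul tF)
  have r1 := tendsto_nhds_unique (l1.congr' e1) tendsto_const_nhds
  -- second relation
  have e2 : ∀ᶠ r in 𝓝[>] (0:ℝ), (p + 1 + 2 * n) * N r + r * deriv N r
      + 2 * (r * x r) * S r ^ 2 * G r = 0 := by
    have hW : ∀ᶠ r in 𝓝[>] (0:ℝ), r * γ * s r ^ 2 * u r = γ * (r ^ (p + 1 + 2 * n) * N r) := by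
      filter_upwards [self_mem_nhdsWithin, hu, hs] with r hr hu hs
      have hr : 0 < r := hr
      rw [hu, hs]
      have : r ^ (p + 1 + 2 * n) = r ^ p * r * (r ^ (n:ℝ)) ^ 2 := by
        rw [rpow_add hr, rpow_add_one hr.ne', two_mul, rpow_add hr]; ring
      rw [this, hNdef]; ring
    filter_upwards [self_mem_nhdsWithin, hv, hs, ev_nhds hW, hle hN.eventually_analyticAt]
      with r hr hv hs hW2 hNr
    have hr : 0 < r := hr
    have hd : HasDerivAt (fun t => γ * (t ^ (p + 1 + 2 * n) * N t))
        (γ * ((p + 1 + 2 * n) * r ^ ((p + 1 + 2 * n) - 1) * N r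
          + r ^ (p + 1 + 2 * n) * deriv N r)) r :=
      ((hasDerivAt_rpow_const (Or.inl hr.ne')).mul hNr.differentiableAt.hasDerivAt).const_mul γ
    have hW' := (hWd r hr).unique (hd.congr_of_eventuallyEq hW2)
    have hI := hIlin r hr
    rw [hW', hv, hs] at hI
    have h1 : r ^ (p + 1 + 2 * n) = r ^ p * r * (r ^ (n:ℝ)) ^ 2 := by
      rw [rpow_add hr, rpow_add_one hr.ne', two_mul, rpow_add hr]; ring
    have h2 : r ^ (p + 1 + 2 * n - 1) = r ^ p * (r ^ (n:ℝ)) ^ 2 := by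
      rw [show p + 1 + 2 * (n:ℝ) - 1 = p + (n + n) by ring, rpow_add hr, rpow_add hr]; ring
    rw [h1, h2] at hI
    have h3 : γ * (r ^ p * (r ^ (n:ℝ)) ^ 2) ≠ 0 := by positivity
    apply (mul_right_inj' h3).1
    rw [mul_zero, ← hI]; ring
  have l2 := ((tN.const_mul (p + 1 + 2 * n)).add (tid.mul tN')).add
    (((hx0.const_mul 2).mul (tS.pow 2)).mul tG)
  have r2 := tendsto_nhds_unique (l2.congr' e2) tendsto_const_nhds
  have hN0 : N 0 = s₀ ^ 2 * F 0 := by simp [hNdef, hS0]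
  rw [hN0, hS0] at r2
  have hY : Y0 ≠ 0 := by rintro rfl; simp at hXY
  have q1 : (p + 1) * G 0 + 2 * Y0 * F 0 = 0 := by
    apply (mul_right_inj' hY).1
    linear_combination r1
  have q2 : (p + 1 + 2 * n) * F 0 + 2 * X0 * G 0 = 0 := by
    have : s₀ ^ 2 ≠ 0 := by positivity
    apply (mul_right_inj' this).1
    linear_combination r2
  have hD : 0 < (p + 1) * (p + 1 + 2 * n) - 4 * (X0 * Y0) := by
    have : 0 < (p + 1) * (p + 1 + 2 * n) := mul_pos (by linarith) (by linarith)
    linarith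
  constructor
  · apply (mul_right_inj' hD.ne').1
    linear_combination (p + 1) * q2 - 2 * X0 * q1
  · apply (mul_right_inj' hD.ne').1
    linear_combination (p + 1 + 2 * n) * q1 - 2 * Y0 * q2

/-- Uniqueness for the first order linear system. -/
lemma unique_sys (u v u' v' v'' A B C D E : ℝ → ℝ)
    (hA : ContinuousOn A (Ioi 0)) (hB : ContinuousOn B (Ioi 0)) (hC : ContinuousOn C (Ioi 0))
    (hD : ContinuousOn D (Ioi 0)) (hE : ContinuousOn E (Ioi 0))
    (hud : ∀ r ∈ Set.Ioi (0:ℝ), HasDerivAt u (u' r) r)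
    (hvd : ∀ r ∈ Set.Ioi (0:ℝ), HasDerivAt v (v' r) r)
    (hvd' : ∀ r ∈ Set.Ioi (0:ℝ), HasDerivAt v' (v'' r) r)
    (h1 : ∀ r : ℝ, 0 < r → u' r = A r * u r + B r * v r)
    (h2 : ∀ r : ℝ, 0 < r → v'' r = C r * u r + D r * v r + E r * v' r)
    (r1 : ℝ) (hr1 : 0 < r1) (hu0 : u r1 = 0) (hv0 : v r1 = 0) (hv0' : v' r1 = 0) :
    ∀ r : ℝ, 0 < r → u r = 0 ∧ v r = 0 := by
  have key := zero_prop (fun r => (u r, v r, v' r)) (fun r => ((u' r, v' r, v'' r) : ℝ × ℝ × ℝ))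
    (fun r hr => (hud r hr).prodMk ((hvd r hr).prodMk (hvd' r hr))) (by
      intro a b ha
      obtain ⟨KA, hKA, bA⟩ := bdd_of_cont A hA a b ha
      obtain ⟨KB, hKB, bB⟩ := bdd_of_cont B hB a b ha
      obtain ⟨KC, hKC, bC⟩ := bdd_of_cont C hC a b ha
      obtain ⟨KD, hKD, bD⟩ := bdd_of_cont D hD a b ha
      obtain ⟨KE, hKE, bE⟩ := bdd_of_cont E hE a b ha
      refine ⟨1 + KA + KB + KC + KD + KE, fun r hr => ?_⟩
      have hr0 : 0 < r := ha.trans_le hr.1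
      set M := ‖(u r, v r, v' r)‖ with hM
      have hM0 : 0 ≤ M := norm_nonneg _
      have n1 : |u r| ≤ M := norm_fst_le (u r, v r, v' r)
      have n0 : ‖(v r, v' r)‖ ≤ M := norm_snd_le (u r, v r, v' r)
      have n2 : |v r| ≤ M := (norm_fst_le (v r, v' r)).trans n0
      have n3 : |v' r| ≤ M := (norm_snd_le (v r, v' r)).trans n0
      have pA := mul_nonneg hKA hM0
      have pB := mul_nonneg hKB hM0
      have pC := mul_nonneg hKC hM0
      have pD := mul_nonneg hKD hM0
      have pE := mul_nonneg hKE hM0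
      have mA := mul_le_mul (bA r hr) n1 (abs_nonneg _) hKA
      have mB := mul_le_mul (bB r hr) n2 (abs_nonneg _) hKB
      have mC := mul_le_mul (bC r hr) n1 (abs_nonneg _) hKC
      have mD := mul_le_mul (bD r hr) n2 (abs_nonneg _) hKD
      have mE := mul_le_mul (bE r hr) n3 (abs_nonneg _) hKE
      rw [← abs_mul] at mA mB mC mD mE
      rw [Prod.norm_def, Prod.norm_def]
      simp only [Real.norm_eq_abs]
      refine max_le ?_ (max_le ?_ ?_)
      · rw [h1 r hr0]
        have := abs_add_le (A r * u r) (B r * v r)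
        linarith
      · linarith
      · rw [h2 r hr0]
        have := abs_add_three (C r * u r) (D r * v r) (E r * v' r)
        linarith) r1 hr1 (by simp [hu0, hv0, hv0'])
  intro r hr
  have := key r hr
  simp only [Prod.mk_eq_zero] at this
  exact ⟨this.1, this.2.1⟩

/-- Theorem 3 of the paper: in the one-component Higgs gauge, a perturbative
(linearized) solution of the Euler–Lagrange equations about the embedded
Nielsen–Olesen configuration does not exist for any `β > 0`, `0 < γ ≤ 1`;
i.e. any linearized solution `u, v` with the stated boundary behavior vanishes. -/
theorem statement8 (β γ : ℝ) (hβ : 0 < β) (hγ : γ ∈ Set.Ioc (0:ℝ) 1)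
    (n m : ℤ) (hn : 1 ≤ n)
    (s z s' s'' z' z'' : ℝ → ℝ) (z₀ s₀ : ℝ)
    (hsd : ∀ r ∈ Set.Ioi (0:ℝ), HasDerivAt s (s' r) r)
    (hsd' : ∀ r ∈ Set.Ioi (0:ℝ), HasDerivAt s' (s'' r) r)
    (hzd : ∀ r ∈ Set.Ioi (0:ℝ), HasDerivAt z (z' r) r)
    (hzd' : ∀ r ∈ Set.Ioi (0:ℝ), HasDerivAt z' (z'' r) r)
    (hspos : ∀ r : ℝ, 0 < r → 0 < s r)
    (hNOs : ∀ r ∈ Set.Ioi (0:ℝ),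
      s'' r + s' r / r - (z r ^ 2 + β / 2 * (s r ^ 2 - 1)) * s r = 0)
    (hNOz : ∀ r ∈ Set.Ioi (0:ℝ),
      z'' r + z' r / r - z r / r ^ 2 - z r * s r ^ 2 = 0)
    (hza : ∃ a : ℝ, 0 < a ∧ ∀ r : ℝ, 0 < r → r < a → 0 < z r)
    (hzinf : Filter.Tendsto z Filter.atTop (nhds 0))
    (hrzinf : Filter.Tendsto (fun r => r * z r) Filter.atTop (nhds 0))
    (hz0 : Filter.Tendsto (fun r => (z r - (n:ℝ) / r) / r)
      (nhdsWithin 0 (Set.Ioi 0)) (nhds z₀))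
    (hg0 : Filter.Tendsto (fun r => z' r + z r / r)
      (nhdsWithin 0 (Set.Ioi 0)) (nhds (2 * z₀)))
    (hginf : Filter.Tendsto (fun r => z' r + z r / r) Filter.atTop (nhds 0))
    (hintzs : MeasureTheory.IntegrableOn (fun r => z r * s r ^ 2) (Set.Ioi 0))
    (hanal : ∃ δ : ℝ, 0 < δ ∧ ∃ S Z : ℝ → ℝ,
      AnalyticOnNhd ℝ S (Set.Ioo (-δ) δ) ∧ AnalyticOnNhd ℝ Z (Set.Ioo (-δ) δ) ∧
      (∀ r ∈ Set.Ioo (0:ℝ) δ, S r = s r / r ^ n ∧ Z r = z r - (n:ℝ) / r))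
    (hs₀ : Filter.Tendsto (fun r => s r / r ^ n)
      (nhdsWithin 0 (Set.Ioi 0)) (nhds s₀))
    (hs₀pos : 0 < s₀)
    (x y y' u v u' v' v'' W' : ℝ → ℝ)
    (hxdef : ∀ r : ℝ, x r = (γ - 1) * z r - (2 * γ * (n:ℝ) + (m:ℝ)) / (2 * r))
    (hydef : ∀ r : ℝ, y r = γ * z r - (2 * γ * (n:ℝ) + (m:ℝ)) / (2 * r))
    (hyd : ∀ r ∈ Set.Ioi (0:ℝ), HasDerivAt y (y' r) r)
    (hud : ∀ r ∈ Set.Ioi (0:ℝ), HasDerivAt u (u' r) r)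
    (hvd : ∀ r ∈ Set.Ioi (0:ℝ), HasDerivAt v (v' r) r)
    (hvd' : ∀ r ∈ Set.Ioi (0:ℝ), HasDerivAt v' (v'' r) r)
    (hWd : ∀ r ∈ Set.Ioi (0:ℝ),
      HasDerivAt (fun t => t * γ * s t ^ 2 * u t) (W' r) r)
    (hVlin : ∀ r ∈ Set.Ioi (0:ℝ),
      v'' r + v' r / r - v r / r ^ 2
        + 2 * (2 * y' r * u r + y r * u' r + y r * u r / r)
        - γ * v r * s r ^ 2 = 0)
    (hUlin : ∀ r ∈ Set.Ioi (0:ℝ),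
      v' r * y r - v r * y' r + (2 * y r ^ 2 + γ / 2 * s r ^ 2) * u r = 0)
    (hIlin : ∀ r ∈ Set.Ioi (0:ℝ),
      W' r + 2 * r * γ * x r * s r ^ 2 * v r = 0)
    (hbdry : ∃ k : ℝ, -(1/2:ℝ) < k ∧ ∃ u₀ v₀ : ℝ, ∃ δ : ℝ, 0 < δ ∧
      ∃ F G : ℝ → ℝ, AnalyticOn ℝ F (Set.Ico 0 δ) ∧ AnalyticOn ℝ G (Set.Ico 0 δ) ∧
        (∀ r ∈ Set.Ioo (0:ℝ) δ, F r = u r / r ^ k ∧ G r = v r / r ^ k) ∧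
        F 0 = u₀ ∧ G 0 = v₀)
    (huinf : Filter.Tendsto u Filter.atTop (nhds 0))
    (hvinf : Filter.Tendsto v Filter.atTop (nhds 0))
    (hcond : (∀ r : ℝ, 0 < r → y r ≠ 0) →
      (Filter.Tendsto (fun r => r * u r * v r * γ * s r ^ 2 / y r)
          (nhdsWithin 0 (Set.Ioi 0)) (nhds 0)
        ∧ Filter.Tendsto (fun r => r * u r * v r * γ * s r ^ 2 / y r)
          Filter.atTop (nhds 0)
        ∧ MeasureTheory.IntegrableOn
          (deriv (fun r => r * u r * v r * γ * s r ^ 2 / y r)) (Set.Ioi 0)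
        ∧ MeasureTheory.IntegrableOn
          (fun r => 2 * r * (1 + γ * s r ^ 2 / (4 * y r ^ 2)) * γ * s r ^ 2 * u r ^ 2)
          (Set.Ioi 0)
        ∧ MeasureTheory.IntegrableOn
          (fun r => 2 * r * (x r / y r) * γ * s r ^ 2 * v r ^ 2) (Set.Ioi 0))) :
    ∀ r : ℝ, 0 < r → u r = 0 ∧ v r = 0 := by
  have hγ0 : 0 < γ := hγ.1
  have hγ1 : γ ≤ 1 := hγ.2
  have hn' : (1:ℝ) ≤ n := by exact_mod_cast hn
  have hle : 𝓝[>] (0:ℝ) ≤ 𝓝 0 := nhdsWithin_le_nhds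
  have tid : Tendsto (fun r : ℝ => r) (𝓝[>] 0) (𝓝 0) := hle
  have hsc : ContinuousOn s (Ioi 0) := fun r hr => (hsd r hr).continuousAt.continuousWithinAt
  have hsc' : ContinuousOn s' (Ioi 0) := fun r hr => (hsd' r hr).continuousAt.continuousWithinAt
  have hzc : ContinuousOn z (Ioi 0) := fun r hr => (hzd r hr).continuousAt.continuousWithinAt
  have hzc' : ContinuousOn z' (Ioi 0) := fun r hr => (hzd' r hr).continuousAt.continuousWithinAt
  have hic : ContinuousOn (fun r : ℝ => 1 / r) (Ioi 0) :=
    continuousOn_const.div continuousOn_id (fun r hr => (ne_of_gt hr))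
  -- limits at the origin
  have hf0 : Tendsto (fun r => r * z r) (𝓝[>] 0) (𝓝 (n:ℝ)) := by
    have h := ((tid.pow 2).mul hz0).add_const (n:ℝ)
    have e : (0:ℝ) ^ 2 * z₀ + n = n := by ring
    rw [e] at h
    refine h.congr' ?_
    filter_upwards [self_mem_nhdsWithin] with r hr
    have hr : r ≠ 0 := ne_of_gt hr
    field_simp
    ring
  have hfb := f_bounds n hn s z z' z'' hsc hzd hzd' hspos hNOz hrzinf hf0 hginf
  have hy'eq : ∀ r : ℝ, 0 < r → y' r = γ * z' r + (2 * γ * n + m) / 2 * (1 / r) ^ 2 := by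
    intro r hr
    have h1 : HasDerivAt (fun r => γ * z r - (2 * γ * n + m) / 2 * r⁻¹)
        (γ * z' r - (2 * γ * n + m) / 2 * (-(r ^ 2)⁻¹)) r :=
      ((hzd r hr).const_mul γ).sub ((hasDerivAt_inv hr.ne').const_mul _)
    have h2 : y = fun r => γ * z r - (2 * γ * n + m) / 2 * r⁻¹ := by
      funext t
      rw [hydef t, div_mul_eq_div_div, div_eq_mul_inv _ t]
    rw [← h2] at h1
    rw [(hyd r hr).unique h1, one_div, inv_pow]; ring
  have hry : ∀ r : ℝ, 0 < r → r * y r = γ * (r * z r - n) - m / 2 := by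
    intro r hr
    rw [hydef]; field_simp; ring
  have hrx : ∀ r : ℝ, 0 < r → r * x r = (γ - 1) * (r * z r) - γ * n - m / 2 := by
    intro r hr
    rw [hxdef]; field_simp; ring
  have hy0 : Tendsto (fun r => r * y r) (𝓝[>] 0) (𝓝 (-(m:ℝ) / 2)) := by
    have h := ((hf0.sub_const (n:ℝ)).const_mul γ).sub_const ((m:ℝ) / 2)
    have e : γ * ((n:ℝ) - n) - m / 2 = -(m:ℝ) / 2 := by ring
    rw [e] at h
    refine h.congr' ?_
    filter_upwards [self_mem_nhdsWithin] with r hr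
    exact (hry r hr).symm
  have hx0 : Tendsto (fun r => r * x r) (𝓝[>] 0) (𝓝 (-(n:ℝ) - m / 2)) := by
    have h := ((hf0.const_mul (γ - 1)).sub_const (γ * (n:ℝ))).sub_const ((m:ℝ) / 2)
    have e : (γ - 1) * (n:ℝ) - γ * n - m / 2 = -(n:ℝ) - m / 2 := by ring
    rw [e] at h
    refine h.congr' ?_
    filter_upwards [self_mem_nhdsWithin] with r hr
    exact (hrx r hr).symm
  have hy1 : Tendsto (fun r => r ^ 2 * y' r) (𝓝[>] 0) (𝓝 (-(-(m:ℝ) / 2))) := by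
    have h := ((((tid.pow 2).mul hg0).sub hf0).const_mul γ).add_const ((2 * γ * n + m) / 2)
    have e : γ * ((0:ℝ) ^ 2 * (2 * z₀) - n) + (2 * γ * n + m) / 2 = (-(-(m:ℝ) / 2)) := by ring
    rw [e] at h
    refine h.congr' ?_
    filter_upwards [self_mem_nhdsWithin] with r hr
    rw [hy'eq r hr]
    have hr : r ≠ 0 := ne_of_gt hr
    field_simp
    ring
  obtain ⟨k, hk, u₀, v₀, δ, hδ, F, G, hF, hG, hFG, hF0, hG0⟩ := hbdry
  by_cases hm : -2 * n < m ∧ m < 0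
  · -- indicial case
    have hm1 : -2 * (n:ℝ) < m := by exact_mod_cast hm.1
    have hm2 : (m:ℝ) < 0 := by exact_mod_cast hm.2
    have hins : ∀ {H H1 : ℝ → ℝ}, H =ᶠ[𝓝[insert 0 (Ico 0 δ)] 0] H1 →
        ∀ᶠ r in 𝓝[>] (0:ℝ), H r = H1 r := by
      intro H H1 h
      rw [insert_eq_of_mem (left_mem_Ico.2 hδ), nhdsWithin_Ico_eq_nhdsGE hδ] at h
      exact nhdsWithin_mono _ Ioi_subset_Ici_self h
    obtain ⟨F1, hFF1, hF1⟩ := analyticWithinAt_iff_exists_analyticAt.1 (hF 0 (left_mem_Ico.2 hδ))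
    obtain ⟨G1, hGG1, hG1⟩ := analyticWithinAt_iff_exists_analyticAt.1 (hG 0 (left_mem_Ico.2 hδ))
    have hu1 : ∀ᶠ r in 𝓝[>] (0:ℝ), u r = r ^ k * F1 r := by
      filter_upwards [hins hFF1, Ioo_mem_nhdsGT hδ] with r h1 h2
      have h3 : r ^ k ≠ 0 := (rpow_pos_of_pos h2.1 _).ne'
      rw [← h1, (hFG r h2).1]; field_simp
    have hv1 : ∀ᶠ r in 𝓝[>] (0:ℝ), v r = r ^ k * G1 r := by
      filter_upwards [hins hGG1, Ioo_mem_nhdsGT hδ] with r h1 h2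
      have h3 : r ^ k ≠ 0 := (rpow_pos_of_pos h2.1 _).ne'
      rw [← h1, (hFG r h2).2]; field_simp
    obtain ⟨ε, hε, S, Z, hS, -, hSZ⟩ := hanal
    have hSan : AnalyticAt ℝ S 0 := hS 0 ⟨by linarith, hε⟩
    have hS0 : S 0 = s₀ := by
      refine tendsto_nhds_unique (hSan.continuousAt.tendsto.mono_left hle) (hs₀.congr' ?_)
      filter_upwards [Ioo_mem_nhdsGT hε] with r hr
      exact (hSZ r hr).1.symm
    have hs1 : ∀ᶠ r in 𝓝[>] (0:ℝ), s r = r ^ (n:ℝ) * S r := by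
      filter_upwards [Ioo_mem_nhdsGT hε] with r hr
      have h3 : r ^ n ≠ 0 := (zpow_pos hr.1 _).ne'
      rw [rpow_intCast, (hSZ r hr).1]; field_simp
    have hH : AnalyticAt ℝ (fun r => (F1 r, G1 r)) 0 := hF1.prod hG1
    have hev : ∀ᶠ r in 𝓝 (0:ℝ), (F1 r, G1 r) = 0 := by
      by_contra hcon
      obtain ⟨j, g, hg, hg0, hgeq⟩ := hH.exists_eventuallyEq_pow_smul_nonzero_iff.2 hcon
      have hz := indicial γ hγ0 n hn (k + j) (-(n:ℝ) - m / 2) (-(m:ℝ) / 2) s₀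
        (by have : (0:ℝ) ≤ j := Nat.cast_nonneg j
            linarith)
        (mul_neg_of_neg_of_pos (by linarith) (by linarith)) hs₀pos s x y y' u v v' W'
        (fun r => (g r).1) (fun r => (g r).2) S
        ((analyticAt_fst).comp hg) ((analyticAt_snd).comp hg) hSan hS0
        (by
          filter_upwards [hu1, hle hgeq, self_mem_nhdsWithin] with r h1 h2 hr
          have h3 := congrArg Prod.fst h2
          simp only [sub_zero, Prod.smul_fst, smul_eq_mul] at h3
          rw [h1, h3, rpow_add hr, rpow_natCast]; ring)
        (by
          filter_upwards [hv1, hle hgeq, self_mem_nhdsWithin] with r h1 h2 hr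
          have h3 := congrArg Prod.snd h2
          simp only [sub_zero, Prod.smul_snd, smul_eq_mul] at h3
          rw [h1, h3, rpow_add hr, rpow_natCast]; ring)
        hs1 hy0 hy1 hx0 hvd hWd hUlin hIlin
      exact hg0 (Prod.ext hz.1 hz.2)
    have hvz : ∀ᶠ r in 𝓝[>] (0:ℝ), v r = 0 := by
      filter_upwards [hv1, hle hev] with r h1 h2
      have h3 := congrArg Prod.snd h2
      simp only [Prod.snd_zero] at h3
      rw [h1, h3, mul_zero]
    have huz : ∀ᶠ r in 𝓝[>] (0:ℝ), u r = 0 := by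
      filter_upwards [hu1, hle hev] with r h1 h2
      have h3 := congrArg Prod.fst h2
      simp only [Prod.fst_zero] at h3
      rw [h1, h3, mul_zero]
    obtain ⟨r1, ⟨hvr, hur⟩, hr1⟩ := (((ev_nhds hvz).and huz).and self_mem_nhdsWithin).exists
    have hr1 : 0 < r1 := hr1
    have hvr' : v' r1 = 0 :=
      (hvd r1 hr1).unique ((hasDerivAt_const r1 (0:ℝ)).congr_of_eventuallyEq hvr)
    have hxc : ContinuousOn x (Ioi 0) := by
      refine ((hzc.const_mul (γ - 1)).sub (hic.const_mul ((2 * γ * n + m) / 2))).congr ?_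
      intro r hr
      have hr : r ≠ 0 := ne_of_gt hr
      simp only [hxdef, Pi.sub_apply]; field_simp
    have hyc : ContinuousOn y (Ioi 0) := fun r hr => (hyd r hr).continuousAt.continuousWithinAt
    have hyc' : ContinuousOn y' (Ioi 0) :=
      ((hzc'.const_mul γ).add ((hic.pow 2).const_mul ((2 * γ * n + m) / 2))).congr
        (fun r hr => hy'eq r hr)
    have hAc : ContinuousOn (fun r => -(1 / r + 2 * (s' r / s r))) (Ioi 0) :=
      (hic.add ((hsc'.div hsc (fun r hr => (hspos r hr).ne')).const_mul 2)).neg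
    have hu'eq : ∀ r : ℝ, 0 < r → u' r = -(1 / r + 2 * (s' r / s r)) * u r + -2 * x r * v r := by
      intro r hr
      have h1 := (((hasDerivAt_id r).mul_const γ).mul ((hsd r hr).pow 2)).mul (hud r hr)
      have h2 := (hWd r hr).unique h1
      have h3 := hIlin r hr
      rw [h2] at h3
      have hs := (hspos r hr).ne'
      have hr' := hr.ne'
      simp at h3
      have h4 : r * γ * s r ^ 2 ≠ 0 := by positivity
      have h5 : r * γ * s r ^ 2 * (-(1 / r + 2 * (s' r / s r)) * u r + -2 * x r * v r)
          = -((γ * s r ^ 2 + r * γ * (2 * s r * s' r)) * u r) - 2 * r * γ * x r * s r ^ 2 * v r := by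
        field_simp
        ring
      apply (mul_right_inj' h4).1
      rw [h5]
      linear_combination h3
    refine unique_sys u v u' v' v'' (fun r => -(1 / r + 2 * (s' r / s r))) (fun r => -2 * x r)
      (fun r => -4 * y' r - 2 * y r * (-(1 / r + 2 * (s' r / s r))) - 2 * y r * (1 / r))
      (fun r => (1 / r) ^ 2 + γ * s r ^ 2 - 2 * y r * (-2 * x r)) (fun r => -(1 / r))
      hAc (hxc.const_mul (-2))
      (((hyc'.const_mul (-4)).sub ((hyc.const_mul 2).mul hAc)).sub ((hyc.const_mul 2).mul hic))
      (((hic.pow 2).add ((hsc.pow 2).const_mul γ)).sub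
        ((hyc.const_mul 2).mul (hxc.const_mul (-2))))
      hic.neg hud hvd hvd' hu'eq ?_ r1 hr1 hur hvr.self_of_nhds hvr'
    intro r hr
    have h1 := hVlin r hr
    rw [hu'eq r hr] at h1
    linear_combination h1
  · -- integral identity case
    have hxy : (∀ r : ℝ, 0 < r → y r ≠ 0) ∧ (∀ r : ℝ, 0 < r → 0 ≤ x r / y r) ∧
        (m = 0 → ∀ r : ℝ, 0 < r → x r ≠ 0) := by
      have hcase : (0:ℝ) ≤ m ∨ (m:ℝ) ≤ -2 * n := by
        by_cases h : m < 0
        · right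
          have : m ≤ -2 * n := by by_contra h2; exact hm ⟨by omega, h⟩
          exact_mod_cast this
        · left
          have : 0 ≤ m := by omega
          exact_mod_cast this
      have hratio : ∀ r : ℝ, 0 < r → x r / y r = (r * x r) / (r * y r) :=
        fun r hr => (mul_div_mul_left _ _ hr.ne').symm
      rcases hcase with h | h
      · have hX : ∀ r : ℝ, 0 < r → r * x r < 0 := by
          intro r hr
          rw [hrx r hr]
          nlinarith [hfb r hr, mul_nonneg (sub_nonneg.2 hγ1) (hfb r hr).1.le,
            mul_pos hγ0 (by linarith : (0:ℝ) < n)]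
        have hY : ∀ r : ℝ, 0 < r → r * y r < 0 := by
          intro r hr
          rw [hry r hr]
          nlinarith [mul_pos hγ0 (sub_pos.2 (hfb r hr).2)]
        refine ⟨fun r hr h0 => ?_, fun r hr => ?_, fun _ r hr h0 => ?_⟩
        · have := hY r hr; rw [h0] at this; simp at this
        · rw [hratio r hr]; exact div_nonneg_of_nonpos (hX r hr).le (hY r hr).le
        · have := hX r hr; rw [h0] at this; simp at this
      · have hX : ∀ r : ℝ, 0 < r → 0 ≤ r * x r := by
          intro r hr
          rw [hrx r hr]
          nlinarith [mul_nonneg (sub_nonneg.2 hγ1) (sub_pos.2 (hfb r hr).2).le]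
        have hY : ∀ r : ℝ, 0 < r → 0 < r * y r := by
          intro r hr
          rw [hry r hr]
          nlinarith [mul_nonneg (sub_nonneg.2 hγ1) (by linarith : (0:ℝ) ≤ n),
            mul_pos hγ0 (hfb r hr).1]
        refine ⟨fun r hr h0 => ?_, fun r hr => ?_, fun hm0 r hr h0 => ?_⟩
        · have := hY r hr; rw [h0] at this; simp at this
        · rw [hratio r hr]; exact div_nonneg (hX r hr) (hY r hr).le
        · rw [hm0] at h; simp at h; linarith
    obtain ⟨hyne, hxy0, hx_ne⟩ := hxy
    obtain ⟨hΦ0, hΦinf, -, -, -⟩ := hcond hyne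
    have hq : ∀ r : ℝ, 0 < r → HasDerivAt (fun r => v r / y r)
        (-(2 + γ * s r ^ 2 / (2 * y r ^ 2)) * u r) r := by
      intro r hr
      refine ((hvd r hr).div (hyd r hr) (hyne r hr)).congr_deriv ?_
      have h1 := hUlin r hr
      have := hyne r hr
      rw [div_eq_iff (pow_ne_zero 2 this)]
      field_simp
      linear_combination 2 * h1
    have hΦd : ∀ r : ℝ, 0 < r → HasDerivAt (fun r => r * u r * v r * γ * s r ^ 2 / y r)
        (-(2 * r * (1 + γ * s r ^ 2 / (4 * y r ^ 2)) * γ * s r ^ 2 * u r ^ 2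
          + 2 * r * (x r / y r) * γ * s r ^ 2 * v r ^ 2)) r := by
      intro r hr
      have h1 := (hWd r hr).mul (hq r hr)
      have e : (fun r => r * u r * v r * γ * s r ^ 2 / y r)
          = (fun t => t * γ * s t ^ 2 * u t) * (fun r => v r / y r) := by
        funext t; simp only [Pi.mul_apply]; ring
      rw [e]
      refine h1.congr_deriv ?_
      have h2 := hIlin r hr
      have h3 : W' r = -(2 * r * γ * x r * s r ^ 2 * v r) := by linarith
      have := hyne r hr
      rw [h3]
      field_simp
      ring
    have hA0 : ∀ r : ℝ, 0 < r →
        0 ≤ 2 * r * (1 + γ * s r ^ 2 / (4 * y r ^ 2)) * γ * s r ^ 2 * u r ^ 2 := by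
      intro r hr; positivity
    have hB0 : ∀ r : ℝ, 0 < r → 0 ≤ 2 * r * (x r / y r) * γ * s r ^ 2 * v r ^ 2 := by
      intro r hr
      have := hxy0 r hr
      positivity
    have hanti := anti_of_deriv _ _ hΦd (fun r hr => by linarith [hA0 r hr, hB0 r hr])
    have hΦz : ∀ r : ℝ, 0 < r → r * u r * v r * γ * s r ^ 2 / y r = 0 := fun r hr =>
      le_antisymm (anti_le _ _ hanti hΦ0 r hr) (anti_ge _ _ hanti hΦinf r hr)
    have hu0 : ∀ r : ℝ, 0 < r → u r = 0 := by
      intro r hr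
      have h1 : HasDerivAt (fun r => r * u r * v r * γ * s r ^ 2 / y r) 0 r := by
        refine (hasDerivAt_const r (0:ℝ)).congr_of_eventuallyEq ?_
        filter_upwards [Ioi_mem_nhds hr] with t ht
        exact hΦz t ht
      have h2 := (hΦd r hr).unique h1
      have h3 : 2 * r * (1 + γ * s r ^ 2 / (4 * y r ^ 2)) * γ * s r ^ 2 * u r ^ 2 = 0 := by
        linarith [hA0 r hr, hB0 r hr]
      have h4 : 0 < 2 * r * (1 + γ * s r ^ 2 / (4 * y r ^ 2)) * γ * s r ^ 2 := by
        have := hspos r hr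
        positivity
      exact pow_eq_zero_iff two_ne_zero |>.1 ((mul_eq_zero.1 h3).resolve_left h4.ne')
    intro r hr
    refine ⟨hu0 r hr, ?_⟩
    by_cases hm0 : m = 0
    · have h1 : HasDerivAt (fun t => t * γ * s t ^ 2 * u t) 0 r := by
        refine (hasDerivAt_const r (0:ℝ)).congr_of_eventuallyEq ?_
        filter_upwards [Ioi_mem_nhds hr] with t ht
        rw [hu0 t ht, mul_zero]
      have h2 := hIlin r hr
      rw [(hWd r hr).unique h1, zero_add] at h2
      have h3 : 2 * r * γ * x r * s r ^ 2 ≠ 0 := by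
        have h4 := (hspos r hr).ne'
        have h5 := hx_ne hm0 r hr
        have h6 := hr.ne'
        have h7 := hγ0.ne'
        positivity
      exact (mul_eq_zero.1 h2).resolve_left h3
    · have hm0' : (m:ℝ) ≠ 0 := by exact_mod_cast hm0
      have hq0 : ∀ r : ℝ, 0 < r → HasDerivAt (fun r => v r / y r) 0 r := by
        intro r hr
        have := hq r hr
        rwa [hu0 r hr, mul_zero] at this
      have ha1 := anti_of_deriv _ _ hq0 (fun _ _ => le_rfl)
      have ha2 := anti_of_deriv _ _ (fun r hr => (hq0 r hr).neg) (fun _ _ => by simp)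
      have hrv : Tendsto (fun r => r * v r) (𝓝[>] 0) (𝓝 0) := by
        have hGc : Tendsto G (𝓝[>] 0) (𝓝 (G 0)) := by
          have h := (hG 0 (left_mem_Ico.2 hδ)).continuousWithinAt.tendsto
          rw [nhdsWithin_Ico_eq_nhdsGE hδ] at h
          exact h.mono_left (nhdsWithin_mono _ Ioi_subset_Ici_self)
        have h1 : Tendsto (fun r : ℝ => r ^ (k + 1)) (𝓝[>] 0) (𝓝 0) := by
          have := (continuousAt_rpow_const (0:ℝ) (k + 1) (Or.inr (by linarith))).tendsto.mono_left
            hle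
          rwa [zero_rpow (by linarith)] at this
        have h2 := h1.mul hGc
        rw [zero_mul] at h2
        refine h2.congr' ?_
        filter_upwards [Ioo_mem_nhdsGT hδ] with r hr
        have h3 : r ^ k ≠ 0 := (rpow_pos_of_pos hr.1 _).ne'
        rw [(hFG r hr).2, rpow_add_one hr.1.ne']; field_simp
      have hlim : Tendsto (fun r => v r / y r) (𝓝[>] 0) (𝓝 0) := by
        have h := hrv.div hy0 (div_ne_zero (neg_ne_zero.2 hm0') two_ne_zero)
        rw [zero_div] at h
        refine h.congr' ?_
        filter_upwards [self_mem_nhdsWithin] with r hr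
        exact mul_div_mul_left _ _ (ne_of_gt hr)
      have b1 := anti_le _ _ ha1 hlim r hr
      have b2 := anti_le _ 0 ha2 (by have h := hlim.neg; rw [neg_zero] at h; exact h) r hr
      have b3 : v r / y r = 0 := by
        have b2 : -(v r / y r) ≤ 0 := b2
        linarith
      exact (div_eq_zero_iff.1 b3).resolve_right (hyne r hr)
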